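/- Suppose M ≥ K and the M×K matrix V_S obtained by selecting M rows of V_K (an N×K matrix) has rank K. Then the matrix Ω̃ = [I_K, Ã_K, …, Ã_K^{T-1}] · (I_T ⊗ V_K^H diag(c)), where diag(c) selects exactly those M rows, has rank K. -/

import Mathlib

open Kronecker Matrix

/-- Sufficient condition for controllability in the mean: if `M ≥ K` rows of
`V_K`, selected by an injection `s` (with indicator `c`), are linearly
independent (i.e. the selected submatrix has rank `K`), then the in-band
controllability matrix `Ω̃` has full rank `K`. -/
theorem bandwidth_controllability_sufficient
    (N K T M : ℕ) (hKN : K ≤ N) (hT : 1 ≤ T) (hMK : M ≥ K)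
    (Atil : Matrix (Fin K) (Fin K) ℂ) (hdiag : Atil.IsDiag)
    (VK : Matrix (Fin N) (Fin K) ℂ)
    (s : Fin M → Fin N) (hs : Function.Injective s)
    (hVS : (VK.submatrix s id).rank = K)
    (c : Fin N → ℂ)
    (hc : c = fun i => if i ∈ Finset.univ.image s then (1 : ℂ) else 0)
    (Ω : Matrix (Fin K) (Fin T × Fin N) ℂ)
    (hΩ : Ω = (Matrix.of fun k (tk : Fin T × Fin K) =>
        (Atil ^ (tk.1 : ℕ)) k tk.2) *
      ((1 : Matrix (Fin T) (Fin T) ℂ) ⊗ₖ (VKᴴ * Matrix.diagonal c))) :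
    Ω.rank = K := by
  have hsub : Ω.submatrix id (fun j => ((⟨0, hT⟩ : Fin T), s j)) = (VK.submatrix s id)ᴴ := by
    ext k j
    subst hΩ
    simp [Matrix.mul_apply, Matrix.kroneckerMap_apply, Fintype.sum_prod_type, Matrix.one_apply,
      Matrix.diagonal_apply, hc, ite_mul]
  have h1 : (VK.submatrix s id)ᴴ.rank = K := by
    open ComplexOrder in rw [Matrix.rank_conjTranspose, hVS]
  apply le_antisymm
  · simpa using Ω.rank_le_card_height
  · calc K = (Ω.submatrix id (fun j => ((⟨0, hT⟩ : Fin T), s j))).rank := by rw [hsub, h1]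
      _ ≤ Ω.rank := Matrix.rank_submatrix_le _ _ _
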